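/- arXiv:2112.10694 — 2 statements merged into one kernel-verified Lean document; each statement's English description precedes it below -/
import Mathlib

section
/- (Basmajian's identity for T_n.) Let n ≥ 1 and for each k ∈ {0,1,…,n−1} let (Φ_k, e_k) be a harmonic weight map on T₁ such that Φ_k(1) = Φ_{k+1 mod n}(0) for every k, and such that sup{ e_k(r,s) : k ∈ {0,…,n−1}, (r,s) a Farey pair } < ∞. Then each family ( log((Φ_k(q)+1)/(Φ_k(q)−1)) )_{q ∈ ℚ ∩ (0,1)} is summable and ∑_{k=0}^{n−1} f(e_k(0,1), Φ_k(0), Φ_k(1)) = ∑_{k=0}^{n−1} log((Φ_k(0)+1)/(Φ_k(0)−1)) + ∑_{k=0}^{n−1} ∑_{q ∈ ℚ ∩ (0,1)} log((Φ_k(q)+1)/(Φ_k(q)−1)). -/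
/-- `arccosh x = log (x + √(x² − 1))`. -/
noncomputable def arccosh (x : ℝ) : ℝ := Real.log (x + Real.sqrt (x ^ 2 - 1))

/-- `f x Y Z = arccosh ((x + Y·Z)/√((Y²−1)(Z²−1)))`. -/
noncomputable def f (x Y Z : ℝ) : ℝ :=
  arccosh ((x + Y * Z) / Real.sqrt ((Y ^ 2 - 1) * (Z ^ 2 - 1)))

/-- `h X = (1/2)·log((X+1)/(X−1))`. -/
noncomputable def h (X : ℝ) : ℝ := (1 / 2) * Real.log ((X + 1) / (X - 1))

/-- `(r, s)` is a Farey pair: `0 ≤ r < s ≤ 1` and, writing `r = p/q`, `s = m/n`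
in lowest terms, `q·m − p·n = 1`. -/
def IsFareyPair (r s : ℚ) : Prop :=
  0 ≤ r ∧ r < s ∧ s ≤ 1 ∧ (r.den : ℤ) * s.num - r.num * (s.den : ℤ) = 1

/-- The mediant `(p+m)/(q+n)` of the Farey pair `(p/q, m/n)`. -/
def mediant (r s : ℚ) : ℚ := ((r.num + s.num : ℤ) : ℚ) / ((r.den + s.den : ℕ) : ℚ)

theorem mediant_num_den {r s : ℚ} (hrs : IsFareyPair r s) :
    (mediant r s).num = r.num + s.num ∧ ((mediant r s).den : ℤ) = r.den + s.den := by
  obtain ⟨-, -, -, hdet⟩ := hrs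
  have hpos : (0 : ℤ) < ((r.den + s.den : ℕ) : ℤ) := by
    have := r.den_pos
    omega
  have hcop : Nat.Coprime (r.num + s.num).natAbs (((r.den + s.den : ℕ) : ℤ)).natAbs := by
    rw [← Int.isCoprime_iff_nat_coprime]
    refine ⟨r.den, -r.num, ?_⟩
    push_cast
    linarith
  have hm : mediant r s =
      ((r.num + s.num : ℤ) : ℚ) / (((r.den + s.den : ℕ) : ℤ) : ℚ) := by
    rw [mediant, Int.cast_natCast]
  rw [hm]
  exact ⟨Rat.num_div_eq_of_coprime hpos hcop, by
    rw [Rat.den_div_eq_of_coprime hpos hcop]; push_cast; rfl⟩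

namespace IsFareyPair

theorem lt_mediant {r s : ℚ} (hrs : IsFareyPair r s) : r < mediant r s := by
  obtain ⟨hn, hd⟩ := mediant_num_den hrs
  obtain ⟨-, -, -, hdet⟩ := hrs
  rw [Rat.lt_iff, hn, hd]
  linarith

theorem mediant_lt {r s : ℚ} (hrs : IsFareyPair r s) : mediant r s < s := by
  obtain ⟨hn, hd⟩ := mediant_num_den hrs
  obtain ⟨-, -, -, hdet⟩ := hrs
  rw [Rat.lt_iff, hn, hd]
  linarith

theorem left {r s : ℚ} (hrs : IsFareyPair r s) : IsFareyPair r (mediant r s) := by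
  obtain ⟨hn, hd⟩ := mediant_num_den hrs
  refine ⟨hrs.1, hrs.lt_mediant, hrs.mediant_lt.le.trans hrs.2.2.1, ?_⟩
  rw [hn, hd]
  linarith [hrs.2.2.2]

theorem right {r s : ℚ} (hrs : IsFareyPair r s) : IsFareyPair (mediant r s) s := by
  obtain ⟨hn, hd⟩ := mediant_num_den hrs
  refine ⟨hrs.1.trans hrs.lt_mediant.le, hrs.mediant_lt, hrs.2.2.1, ?_⟩
  rw [hn, hd]
  linarith [hrs.2.2.2]

theorem mediant_mem_Ioo {r s : ℚ} (hrs : IsFareyPair r s) :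
    mediant r s ∈ Set.Ioo (0 : ℚ) 1 :=
  ⟨hrs.1.trans_lt hrs.lt_mediant, hrs.mediant_lt.trans_le hrs.2.2.1⟩

theorem den_add_den_le {r s q : ℚ} (hrs : IsFareyPair r s) (hrq : r < q) (hqs : q < s) :
    r.den + s.den ≤ q.den := by
  obtain ⟨-, -, -, hdet⟩ := hrs
  rw [Rat.lt_iff] at hrq hqs
  have hr : (0 : ℤ) < r.den := by exact_mod_cast r.den_pos
  have hs : (0 : ℤ) < s.den := by exact_mod_cast s.den_pos
  have hq : (q.den : ℤ) = r.den * (s.num * q.den - q.num * s.den) +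
      s.den * (q.num * r.den - r.num * q.den) := by
    linear_combination (-(q.den : ℤ)) * hdet
  have : (r.den : ℤ) + s.den ≤ q.den := by
    rw [hq]
    nlinarith
  exact_mod_cast this

end IsFareyPair

theorem sum_le_of_subset_Ioo {G : ℚ → ℚ → ℝ} {w : ℚ → ℝ}
    (hG : ∀ r s, IsFareyPair r s → 0 ≤ G r s)
    (hw : ∀ q ∈ Set.Ioo (0 : ℚ) 1, 0 ≤ w q)
    (hadd : ∀ r s, IsFareyPair r s →
      G r s = G r (mediant r s) + w (mediant r s) + G (mediant r s) s)
    (N : ℕ) : ∀ (r s : ℚ), IsFareyPair r s → ∀ F : Finset ℚ,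
      (∀ q ∈ F, q ∈ Set.Ioo r s ∧ q.den < N + r.den + s.den) → ∑ q ∈ F, w q ≤ G r s := by
  induction N with
  | zero =>
    intro r s hrs F hF
    have hF0 : F = ∅ := Finset.eq_empty_of_forall_notMem fun q hq => by
      have h1 := hF q hq
      have h2 := hrs.den_add_den_le h1.1.1 h1.1.2
      omega
    simpa [hF0] using hG r s hrs
  | succ N ih =>
    intro r s hrs F hF
    have hd := (mediant_num_den hrs).2
    set m := mediant r s with hm
    have hr := r.den_pos
    have hs := s.den_pos
    have h1 := ih r m hrs.left {q ∈ F | q < m} fun q hq => by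
      rw [Finset.mem_filter] at hq
      have := hF q hq.1
      exact ⟨⟨this.1.1, hq.2⟩, by omega⟩
    have h2 := ih m s hrs.right {q ∈ F | m < q} fun q hq => by
      rw [Finset.mem_filter] at hq
      have := hF q hq.1
      exact ⟨⟨hq.2, this.1.2⟩, by omega⟩
    have hsub : F ⊆ {q ∈ F | q < m} ∪ {m} ∪ {q ∈ F | m < q} := fun q hq => by
      rcases lt_trichotomy q m with h | h | h <;> simp [hq, h]
    have hd1 : Disjoint {q ∈ F | q < m} {m} := by simp
    have hd2 : Disjoint ({q ∈ F | q < m} ∪ {m}) {q ∈ F | m < q} := by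
      rw [Finset.disjoint_left]
      intro q hq hq'
      simp only [Finset.mem_union, Finset.mem_filter, Finset.mem_singleton] at hq hq'
      rcases hq with hq | hq
      · exact lt_asymm hq.2 hq'.2
      · exact hq'.2.ne' hq
    have hm0 := hw m hrs.mediant_mem_Ioo
    calc ∑ q ∈ F, w q ≤ ∑ q ∈ {q ∈ F | q < m} ∪ {m} ∪ {q ∈ F | m < q}, w q := by
          refine Finset.sum_le_sum_of_subset_of_nonneg hsub fun q hq hqF => ?_
          simp only [Finset.mem_union, Finset.mem_filter, Finset.mem_singleton] at hq
          have hqm : q = m := by tauto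
          rwa [hqm]
      _ = ∑ q ∈ F with q < m, w q + w m + ∑ q ∈ F with m < q, w q := by
          rw [Finset.sum_union hd2, Finset.sum_union hd1, Finset.sum_singleton]
      _ ≤ G r s := by rw [hadd r s hrs]; linarith

theorem exists_finset_le_sum {G : ℚ → ℚ → ℝ} {w : ℚ → ℝ} {c : ℝ} (hc : 0 ≤ c)
    (hadd : ∀ r s, IsFareyPair r s →
      G r s = G r (mediant r s) + w (mediant r s) + G (mediant r s) s)
    (hle : ∀ r s, IsFareyPair r s →
      G r (mediant r s) + G (mediant r s) s ≤ c * G r s)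
    (d : ℕ) : ∀ (r s : ℚ), IsFareyPair r s → ∃ F : Finset ℚ,
      (∀ q ∈ F, q ∈ Set.Ioo r s) ∧ (1 - c ^ d) * G r s ≤ ∑ q ∈ F, w q := by
  induction d with
  | zero => exact fun r s _ => ⟨∅, by simp⟩
  | succ d ih =>
    intro r s hrs
    obtain ⟨F₁, hF₁, h1⟩ := ih _ _ hrs.left
    obtain ⟨F₂, hF₂, h2⟩ := ih _ _ hrs.right
    have hlm := hrs.lt_mediant
    have hml := hrs.mediant_lt
    have hadd' := hadd r s hrs
    have hle' := hle r s hrs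
    set m := mediant r s
    have hd1 : Disjoint F₁ {m} := by
      rw [Finset.disjoint_singleton_right]
      exact fun hm => (hF₁ m hm).2.false
    have hd2 : Disjoint (F₁ ∪ {m}) F₂ := by
      rw [Finset.disjoint_left]
      intro q hq hq'
      rw [Finset.mem_union, Finset.mem_singleton] at hq
      rcases hq with hq | hq
      · exact lt_asymm (hF₁ q hq).2 (hF₂ q hq').1
      · exact (hF₂ q hq').1.ne' hq
    refine ⟨F₁ ∪ {m} ∪ F₂, fun q hq => ?_, ?_⟩
    · simp only [Finset.mem_union, Finset.mem_singleton] at hq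
      rcases hq with (hq | hq) | hq
      · exact ⟨(hF₁ q hq).1, (hF₁ q hq).2.trans hml⟩
      · exact hq ▸ ⟨hlm, hml⟩
      · exact ⟨hlm.trans (hF₂ q hq).1, (hF₂ q hq).2⟩
    · rw [Finset.sum_union hd2, Finset.sum_union hd1, Finset.sum_singleton]
      have := mul_le_mul_of_nonneg_left hle' (pow_nonneg hc d)
      rw [pow_succ]
      linarith

/-- An additive nonnegative weight on Farey intervals that contracts under subdivision is
exhausted by the contributions of the mediants. -/
theorem hasSum_Ioo_of_contracting {G : ℚ → ℚ → ℝ} {w : ℚ → ℝ} {c : ℝ} (hc : 0 ≤ c) (hc1 : c < 1)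
    (hG : ∀ r s, IsFareyPair r s → 0 ≤ G r s)
    (hw : ∀ q ∈ Set.Ioo (0 : ℚ) 1, 0 ≤ w q)
    (hadd : ∀ r s, IsFareyPair r s →
      G r s = G r (mediant r s) + w (mediant r s) + G (mediant r s) s)
    (hle : ∀ r s, IsFareyPair r s →
      G r (mediant r s) + G (mediant r s) s ≤ c * G r s) :
    HasSum (fun q : {q : ℚ // q ∈ Set.Ioo (0 : ℚ) 1} => w q) (G 0 1) := by
  have h01 : IsFareyPair 0 1 := by norm_num [IsFareyPair]
  refine hasSum_of_isLUB_of_nonneg _ (fun q => hw q q.2) ⟨?_, fun b hb => ?_⟩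
  · rintro _ ⟨F, rfl⟩
    have := sum_le_of_subset_Ioo hG hw hadd
      ((F.map (Function.Embedding.subtype _)).sup Rat.den) 0 1 h01
      (F.map (Function.Embedding.subtype _)) fun q hq => ⟨?_, ?_⟩
    · simpa using this
    · obtain ⟨x, -, rfl⟩ := Finset.mem_map.1 hq
      exact x.2
    · have := Finset.le_sup (f := Rat.den) hq
      have := (0 : ℚ).den_pos
      omega
  · have hlim : Filter.Tendsto (fun d : ℕ => (1 - c ^ d) * G 0 1) Filter.atTop
        (nhds ((1 - 0) * G 0 1)) :=
      ((tendsto_pow_atTop_nhds_zero_of_lt_one hc hc1).const_sub 1).mul_const _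
    rw [sub_zero, one_mul] at hlim
    refine le_of_tendsto' hlim fun d => ?_
    obtain ⟨F, hF, hFs⟩ := exists_finset_le_sum hc hadd hle d 0 1 h01
    refine hFs.trans (le_trans (le_of_eq ?_) (hb ⟨F.subtype (· ∈ Set.Ioo (0 : ℚ) 1), rfl⟩))
    exact (Finset.sum_subtype_of_mem w hF).symm

theorem exp_h {X : ℝ} (hX : 1 < X) : Real.exp (h X) = Real.sqrt ((X + 1) / (X - 1)) := by
  have : 0 < (X + 1) / (X - 1) := div_pos (by linarith) (by linarith)
  rw [Real.sqrt_eq_rpow, Real.rpow_def_of_pos this, h, mul_comm]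

theorem h_pos {X : ℝ} (hX : 1 < X) : 0 < h X := by
  have : 1 < (X + 1) / (X - 1) := by
    rw [lt_div_iff₀ (by linarith)]
    linarith
  exact mul_pos (by norm_num) (Real.log_pos this)

theorem one_div_le_two_mul_h {X : ℝ} (hX : 1 < X) : 1 / X ≤ 2 * h X := by
  have h1 : 0 < (X + 1) / (X - 1) := div_pos (by linarith) (by linarith)
  have h2 := Real.one_sub_inv_le_log_of_pos h1
  have h3 : 1 / X ≤ 1 - ((X + 1) / (X - 1))⁻¹ := by
    rw [inv_div, div_le_iff₀ (by linarith), one_sub_div (by linarith), div_mul_eq_mul_div,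
      le_div_iff₀ (by linarith)]
    linarith
  rw [h]
  linarith

theorem cosh_h {X : ℝ} (hX : 1 < X) : Real.cosh (h X) = X / Real.sqrt (X ^ 2 - 1) := by
  have h1 : 0 < X - 1 := by linarith
  have h2 : 0 < X + 1 := by linarith
  have e : X ^ 2 - 1 = (X + 1) * (X - 1) := by ring
  have s1 := Real.sq_sqrt h1.le
  have s2 := Real.sq_sqrt h2.le
  have := Real.sqrt_pos.2 h1
  have := Real.sqrt_pos.2 h2
  rw [Real.cosh_eq, Real.exp_neg, exp_h hX, e, Real.sqrt_div h2.le, Real.sqrt_mul h2.le]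
  field_simp
  linarith

theorem sinh_h {X : ℝ} (hX : 1 < X) : Real.sinh (h X) = 1 / Real.sqrt (X ^ 2 - 1) := by
  have h1 : 0 < X - 1 := by linarith
  have h2 : 0 < X + 1 := by linarith
  have e : X ^ 2 - 1 = (X + 1) * (X - 1) := by ring
  have s1 := Real.sq_sqrt h1.le
  have s2 := Real.sq_sqrt h2.le
  have := Real.sqrt_pos.2 h1
  have := Real.sqrt_pos.2 h2
  rw [Real.sinh_eq, Real.exp_neg, exp_h hX, e, Real.sqrt_div h2.le, Real.sqrt_mul h2.le]
  field_simp
  linarith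

theorem cosh_h_eq_mul_sinh_h {X : ℝ} (hX : 1 < X) : Real.cosh (h X) = X * Real.sinh (h X) := by
  rw [cosh_h hX, sinh_h hX, mul_one_div]

theorem f_eq_arcosh {x Y Z : ℝ} (hY : 1 < Y) (hZ : 1 < Z) :
    f x Y Z = Real.arcosh
      (Real.cosh (h Y + h Z) + (x - 1) * (Real.sinh (h Y) * Real.sinh (h Z))) := by
  have : 0 ≤ Y ^ 2 - 1 := by nlinarith
  rw [Real.cosh_add, cosh_h hY, cosh_h hZ, sinh_h hY, sinh_h hZ]
  change Real.arcosh _ = _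
  rw [Real.sqrt_mul this, div_mul_div_comm, div_mul_div_comm, one_mul]
  congr 1
  ring

theorem cosh_f {x Y Z : ℝ} (hx : 1 < x) (hY : 1 < Y) (hZ : 1 < Z) :
    Real.cosh (f x Y Z) =
      Real.cosh (h Y + h Z) + (x - 1) * (Real.sinh (h Y) * Real.sinh (h Z)) := by
  have hp : 0 ≤ (x - 1) * (Real.sinh (h Y) * Real.sinh (h Z)) :=
    mul_nonneg (by linarith) (mul_nonneg (Real.sinh_nonneg_iff.2 (h_pos hY).le)
      (Real.sinh_nonneg_iff.2 (h_pos hZ).le))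
  rw [f_eq_arcosh hY hZ, Real.cosh_arcosh (by linarith [Real.one_le_cosh (h Y + h Z)])]

theorem f_comm (x Y Z : ℝ) : f x Y Z = f x Z Y := by
  rw [f, f, mul_comm Y, mul_comm (Y ^ 2 - 1)]

theorem h_add_h_le_f {x Y Z : ℝ} (hx : 1 < x) (hY : 1 < Y) (hZ : 1 < Z) :
    h Y + h Z ≤ f x Y Z := by
  have hp : 0 ≤ (x - 1) * (Real.sinh (h Y) * Real.sinh (h Z)) :=
    mul_nonneg (by linarith) (mul_nonneg (Real.sinh_nonneg_iff.2 (h_pos hY).le)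
      (Real.sinh_nonneg_iff.2 (h_pos hZ).le))
  have hf : 0 ≤ f x Y Z := by
    rw [f_eq_arcosh hY hZ]
    exact Real.arcosh_nonneg (by linarith [Real.one_le_cosh (h Y + h Z)])
  have hc : Real.cosh (h Y + h Z) ≤ Real.cosh (f x Y Z) := by
    rw [cosh_f hx hY hZ]
    linarith
  rwa [Real.cosh_le_cosh, abs_of_nonneg (add_pos (h_pos hY) (h_pos hZ)).le,
    abs_of_nonneg hf] at hc

theorem f_sub_le {x Y Z : ℝ} (hx : 1 < x) (hY : 1 < Y) (hZ : 1 < Z) :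
    f x Y Z - h Y - h Z ≤ (x - 1) * (2 * h Y) := by
  set g := f x Y Z - h Y - h Z with hg
  have hg0 : 0 ≤ g := by linarith [h_add_h_le_f hx hY hZ]
  have ha := Real.sinh_pos_iff.2 (h_pos hY)
  have hb := Real.sinh_pos_iff.2 (h_pos hZ)
  have hab := Real.sinh_pos_iff.2 (add_pos (h_pos hY) (h_pos hZ))
  have hcosh := cosh_f hx hY hZ
  rw [show f x Y Z = (h Y + h Z) + g by rw [hg]; ring, Real.cosh_add (h Y + h Z) g] at hcosh
  have h1 := Real.self_le_sinh_iff.2 hg0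
  have h2 := Real.one_le_cosh g
  have h3 : g * Real.sinh (h Y + h Z) ≤ (x - 1) * (Real.sinh (h Y) * Real.sinh (h Z)) := by
    nlinarith [Real.cosh_pos (h Y + h Z)]
  rw [Real.sinh_add, cosh_h_eq_mul_sinh_h hY, cosh_h_eq_mul_sinh_h hZ] at h3
  have h4 : (g * (Y + Z)) * (Real.sinh (h Y) * Real.sinh (h Z)) ≤
      (x - 1) * (Real.sinh (h Y) * Real.sinh (h Z)) := by linarith
  have h5 := le_of_mul_le_mul_right h4 (mul_pos ha hb)
  have h6 : g ≤ (x - 1) * (1 / Y) := by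
    rw [mul_one_div, le_div_iff₀ (by linarith)]
    nlinarith
  exact h6.trans (mul_le_mul_of_nonneg_left (one_div_le_two_mul_h hY) (by linarith))

/-- The identity for a single tree `T₁`, with the boundary terms split off. -/
theorem hasSum_two_mul_h {Φ : ℚ → ℝ} {e : ℚ → ℚ → ℝ} {M : ℝ}
    (hΦ : ∀ q ∈ Set.Icc (0 : ℚ) 1, 1 < Φ q)
    (he : ∀ r s, IsFareyPair r s → 1 < e r s)
    (hharm : ∀ r s, IsFareyPair r s →
      f (e r s) (Φ r) (Φ s) =
        f (e r (mediant r s)) (Φ r) (Φ (mediant r s)) +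
        f (e (mediant r s) s) (Φ (mediant r s)) (Φ s))
    (hM : ∀ r s, IsFareyPair r s → e r s ≤ M) :
    HasSum (fun q : {q : ℚ // q ∈ Set.Ioo (0 : ℚ) 1} => 2 * h (Φ q))
      (f (e 0 1) (Φ 0) (Φ 1) - h (Φ 0) - h (Φ 1)) := by
  have h01 : IsFareyPair 0 1 := by norm_num [IsFareyPair]
  have hM1 : 1 < M := (he 0 1 h01).trans_le (hM 0 1 h01)
  have hl : ∀ r s, IsFareyPair r s → 1 < Φ r := fun r s hrs =>
    hΦ r ⟨hrs.1, hrs.2.1.le.trans hrs.2.2.1⟩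
  have hr : ∀ r s, IsFareyPair r s → 1 < Φ s := fun r s hrs =>
    hΦ s ⟨hrs.1.trans hrs.2.1.le, hrs.2.2.1⟩
  have hadd : ∀ r s, IsFareyPair r s → f (e r s) (Φ r) (Φ s) - h (Φ r) - h (Φ s) =
      (f (e r (mediant r s)) (Φ r) (Φ (mediant r s)) - h (Φ r) - h (Φ (mediant r s))) +
        2 * h (Φ (mediant r s)) +
        (f (e (mediant r s) s) (Φ (mediant r s)) (Φ s) - h (Φ (mediant r s)) - h (Φ s)) :=
    fun r s hrs => by
      rw [hharm r s hrs]
      ring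
  refine hasSum_Ioo_of_contracting (G := fun r s => f (e r s) (Φ r) (Φ s) - h (Φ r) - h (Φ s))
    (w := fun q => 2 * h (Φ q)) (c := 2 * (M - 1) / (1 + 2 * (M - 1)))
    (div_nonneg (by linarith) (by linarith)) ?_ ?_ ?_ hadd ?_
  · rw [div_lt_one (by linarith)]
    linarith
  · intro r s hrs
    linarith [h_add_h_le_f (he r s hrs) (hl r s hrs) (hr r s hrs)]
  · intro q hq
    linarith [h_pos (hΦ q ⟨hq.1.le, hq.2.le⟩)]
  · intro r s hrs
    have hadd' := hadd r s hrs
    have h1 := f_sub_le (he _ _ hrs.left) (hr _ _ hrs.left) (hl _ _ hrs)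
    have h2 := f_sub_le (he _ _ hrs.right) (hl _ _ hrs.right) (hr _ _ hrs)
    rw [f_comm] at h1
    have hm := h_pos (hl _ _ hrs.right)
    have h3 := hM _ _ hrs.left
    have h4 := hM _ _ hrs.right
    rw [div_mul_eq_mul_div, le_div_iff₀ (by linarith)]
    nlinarith

theorem stmt_11 (n : ℕ) (hn : 1 ≤ n) (Φ : Fin n → ℚ → ℝ) (e : Fin n → ℚ → ℚ → ℝ)
    (hΦ : ∀ k, ∀ q ∈ Set.Icc (0 : ℚ) 1, 1 < Φ k q)
    (he : ∀ k r s, IsFareyPair r s → 1 < e k r s)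
    (hharm : ∀ k r s, IsFareyPair r s →
      f (e k r s) (Φ k r) (Φ k s) =
        f (e k r (mediant r s)) (Φ k r) (Φ k (mediant r s)) +
        f (e k (mediant r s) s) (Φ k (mediant r s)) (Φ k s))
    (hglue : ∀ k : Fin n,
      Φ k 1 = Φ ⟨((k : ℕ) + 1) % n, Nat.mod_lt _ (by omega)⟩ 0)
    (hsup : ∃ M : ℝ, ∀ (k : Fin n) (r s : ℚ), IsFareyPair r s → e k r s ≤ M) :
    (∀ k : Fin n, Summable (fun q : {q : ℚ // q ∈ Set.Ioo (0 : ℚ) 1} =>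
        Real.log ((Φ k q + 1) / (Φ k q - 1)))) ∧
      ∑ k : Fin n, f (e k 0 1) (Φ k 0) (Φ k 1) =
        (∑ k : Fin n, Real.log ((Φ k 0 + 1) / (Φ k 0 - 1))) +
        ∑ k : Fin n, ∑' q : {q : ℚ // q ∈ Set.Ioo (0 : ℚ) 1},
          Real.log ((Φ k q + 1) / (Φ k q - 1)) := by
  obtain ⟨M, hM⟩ := hsup
  have hlog : ∀ X : ℝ, Real.log ((X + 1) / (X - 1)) = 2 * h X := fun X => by
    rw [h]
    ring
  simp only [hlog]
  have key := fun k => hasSum_two_mul_h (hΦ k) (he k) (hharm k) (hM k)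
  refine ⟨fun k => (key k).summable, ?_⟩
  simp only [fun k => (key k).tsum_eq]
  have hperm : ∑ k, h (Φ k 1) = ∑ k, h (Φ k 0) := by
    obtain ⟨n, rfl⟩ : ∃ m, n = m + 1 := ⟨n - 1, by omega⟩
    rw [← Equiv.sum_comp (finRotate (n + 1)) fun k => h (Φ k 0)]
    refine Finset.sum_congr rfl fun k _ => ?_
    rw [hglue k, finRotate_apply]
    congr 2
    ext
    simp [Fin.val_add]
  simp only [Finset.sum_sub_distrib, ← Finset.mul_sum]
  linarith
end

section
/- (Identity from Basmajian's identity on the pair of pants with orthobasis a = b = c = 2.) Let Φ : ℚ ∩ [0,1] → ℝ be the function determined by Φ(0) = Φ(1) = 2 and, for every Farey pair (r,s) with mediant m, Φ(m) = 2·Φ(r) + 2·Φ(s) + √(3·(Φ(r)² + Φ(s)² + 4·Φ(r)·Φ(s) + 3)). Then the family ( log((Φ(q)+1)/(Φ(q)−1)) )_{q ∈ ℚ ∩ [0,1]} is summable and the infinite product ∏_{q ∈ ℚ ∩ [0,1]} (Φ(q)+1)/(Φ(q)−1) equals 3·(2 + √3). -/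
theorem IsFareyPair.coprime_add {r s : ℚ} (h : IsFareyPair r s) :
    IsCoprime (r.num + s.num) ((r.den + s.den : ℕ) : ℤ) := by
  refine ⟨r.den, -r.num, ?_⟩
  push_cast
  linear_combination h.2.2.2

theorem IsFareyPair.mediant_num {r s : ℚ} (h : IsFareyPair r s) :
    (mediant r s).num = r.num + s.num := by
  have := Rat.num_div_eq_of_coprime (a := r.num + s.num) (b := ((r.den + s.den : ℕ) : ℤ))
    (by have := r.den_pos; omega) (Int.isCoprime_iff_nat_coprime.mp h.coprime_add)
  simpa [mediant] using this

theorem IsFareyPair.mediant_den {r s : ℚ} (h : IsFareyPair r s) :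
    (mediant r s).den = r.den + s.den := by
  have := Rat.den_div_eq_of_coprime (a := r.num + s.num) (b := ((r.den + s.den : ℕ) : ℤ))
    (by have := r.den_pos; omega) (Int.isCoprime_iff_nat_coprime.mp h.coprime_add)
  have h2 : ((mediant r s).den : ℤ) = ((r.den + s.den : ℕ) : ℤ) := by
    simpa [mediant] using this
  exact_mod_cast h2

theorem IsFareyPair.lt_mediant_s16 {r s : ℚ} (h : IsFareyPair r s) : r < mediant r s := by
  rw [Rat.lt_iff, h.mediant_num, h.mediant_den]
  push_cast
  linarith [h.2.2.2]

theorem IsFareyPair.mediant_lt_s16 {r s : ℚ} (h : IsFareyPair r s) : mediant r s < s := by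
  rw [Rat.lt_iff, h.mediant_num, h.mediant_den]
  push_cast
  linarith [h.2.2.2]

theorem IsFareyPair.left_s16 {r s : ℚ} (h : IsFareyPair r s) : IsFareyPair r (mediant r s) := by
  refine ⟨h.1, h.lt_mediant_s16, h.mediant_lt_s16.le.trans h.2.2.1, ?_⟩
  rw [h.mediant_num, h.mediant_den]
  push_cast
  linarith [h.2.2.2]

theorem IsFareyPair.right_s16 {r s : ℚ} (h : IsFareyPair r s) : IsFareyPair (mediant r s) s := by
  refine ⟨h.1.trans h.lt_mediant_s16.le, h.mediant_lt_s16, h.2.2.1, ?_⟩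
  rw [h.mediant_num, h.mediant_den]
  push_cast
  linarith [h.2.2.2]

theorem isFareyPair_zero_one : IsFareyPair 0 1 := by
  simp [IsFareyPair]

theorem IsFareyPair.den_add_den_le_s16 {r s q : ℚ} (h : IsFareyPair r s) (hr : r < q) (hs : q < s) :
    r.den + s.den ≤ q.den := by
  rw [Rat.lt_iff] at hr hs
  have h1 : (0 : ℤ) < r.den := by exact_mod_cast r.den_pos
  have h2 : (0 : ℤ) < s.den := by exact_mod_cast s.den_pos
  have key : (q.den : ℤ) = s.den * (q.num * r.den - r.num * q.den)
      + r.den * (s.num * q.den - q.num * s.den) := by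
    linear_combination (-(q.den : ℤ)) * h.2.2.2
  have : (r.den + s.den : ℤ) ≤ q.den := by
    rw [key]
    nlinarith
  exact_mod_cast this

/-- The rationals strictly between `r` and `s` obtained from `(r, s)` by at most `n` successive
insertions of mediants. -/
def mediants : ℕ → ℚ → ℚ → Finset ℚ
  | 0, _, _ => ∅
  | n + 1, r, s =>
    insert (mediant r s) (mediants n r (mediant r s) ∪ mediants n (mediant r s) s)

theorem IsFareyPair.mem_Ioo_of_mem_mediants {n : ℕ} {r s q : ℚ} (h : IsFareyPair r s)
    (hq : q ∈ mediants n r s) : r < q ∧ q < s := by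
  induction n generalizing r s with
  | zero => simp [mediants] at hq
  | succ n ih =>
    simp only [mediants, Finset.mem_insert, Finset.mem_union] at hq
    rcases hq with rfl | hq | hq
    · exact ⟨h.lt_mediant_s16, h.mediant_lt_s16⟩
    · exact ⟨(ih h.left_s16 hq).1, (ih h.left_s16 hq).2.trans h.mediant_lt_s16⟩
    · exact ⟨h.lt_mediant_s16.trans (ih h.right_s16 hq).1, (ih h.right_s16 hq).2⟩

theorem IsFareyPair.mem_mediants {n : ℕ} {r s q : ℚ} (h : IsFareyPair r s) (hr : r < q)
    (hs : q < s) (hn : q.den < n + r.den + s.den) : q ∈ mediants n r s := by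
  induction n generalizing r s with
  | zero =>
    have := h.den_add_den_le_s16 hr hs
    omega
  | succ n ih =>
    simp only [mediants, Finset.mem_insert, Finset.mem_union]
    have hd := h.mediant_den
    have h1 := r.den_pos
    have h2 := s.den_pos
    rcases lt_trichotomy q (mediant r s) with hlt | heq | hgt
    · exact .inr (.inl (ih h.left_s16 hr hlt (by omega)))
    · exact .inl heq
    · exact .inr (.inr (ih h.right_s16 hgt hs (by omega)))

theorem IsFareyPair.sum_mediants_succ {r s : ℚ} (h : IsFareyPair r s) (f : ℚ → ℝ) (n : ℕ) :
    ∑ q ∈ mediants (n + 1) r s, f q =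
      ∑ q ∈ mediants n r (mediant r s), f q + f (mediant r s)
        + ∑ q ∈ mediants n (mediant r s) s, f q := by
  have hd : Disjoint (mediants n r (mediant r s)) (mediants n (mediant r s) s) := by
    rw [Finset.disjoint_left]
    intro q h1 h2
    exact lt_asymm (h.left_s16.mem_Ioo_of_mem_mediants h1).2 (h.right_s16.mem_Ioo_of_mem_mediants h2).1
  rw [mediants, Finset.sum_insert, Finset.sum_union hd]
  · ring
  · rw [Finset.mem_union]
    rintro (h1 | h1)
    · exact lt_irrefl _ (h.left_s16.mem_Ioo_of_mem_mediants h1).2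
    · exact lt_irrefl _ (h.right_s16.mem_Ioo_of_mem_mediants h1).1

/-- Three geodesics of the upper half-plane at pairwise distance `arcosh 2`. A geodesic with
endpoints `x < y` is encoded by `α = 2 / (y - x)` and `φ = (x + y) / (y - x)`, so that
`x = (φ - 1) / α`, `y = (φ + 1) / α`, and `φ` is the hyperbolic cosine of its distance to the
geodesic from `0` to `∞`. The first two geodesics lie on the far side of the third one. -/
structure IsGeodesicTriple (α β γ φ ψ χ : ℝ) : Prop where
  left_pos : 0 < α
  right_pos : 0 < β
  two_le_left : 2 ≤ φ
  two_le_right : 2 ≤ ψ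
  scale_nonneg : 0 ≤ 2 * (α + β) - γ
  cosh_nonneg : 0 ≤ 2 * (φ + ψ) - χ
  scale_eq : α ^ 2 + β ^ 2 + γ ^ 2 = 4 * (α * β + α * γ + β * γ)
  cosh_eq : φ ^ 2 + ψ ^ 2 + χ ^ 2 = 4 * (φ * ψ + φ * χ + ψ * χ) + 9
  det_left_right : √3 * (α * ψ - β * φ) = 2 * (α + β) - γ
  det_right_third : √3 * (β * χ - γ * ψ) = 2 * (β + γ) - α
  det_third_left : √3 * (γ * φ - α * χ) = 2 * (γ + α) - β

namespace IsGeodesicTriple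

variable {α β γ φ ψ χ : ℝ}

theorem left_s16 (h : IsGeodesicTriple α β γ φ ψ χ) :
    IsGeodesicTriple α (4 * (α + β) - γ) β φ (4 * (φ + ψ) - χ) ψ where
  left_pos := h.left_pos
  right_pos := by linarith [h.left_pos, h.right_pos, h.scale_nonneg]
  two_le_left := h.two_le_left
  two_le_right := by linarith [h.two_le_left, h.two_le_right, h.cosh_nonneg]
  scale_nonneg := by linarith [h.left_pos, h.right_pos, h.scale_nonneg]
  cosh_nonneg := by linarith [h.two_le_left, h.two_le_right, h.cosh_nonneg]
  scale_eq := by linear_combination h.scale_eq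
  cosh_eq := by linear_combination h.cosh_eq
  det_left_right := by linear_combination 4 * h.det_left_right + h.det_third_left
  det_right_third := by linear_combination 4 * h.det_left_right + h.det_right_third
  det_third_left := by linear_combination -h.det_left_right

theorem right_s16 (h : IsGeodesicTriple α β γ φ ψ χ) :
    IsGeodesicTriple (4 * (α + β) - γ) β α (4 * (φ + ψ) - χ) ψ φ where
  left_pos := by linarith [h.left_pos, h.right_pos, h.scale_nonneg]
  right_pos := h.right_pos
  two_le_left := by linarith [h.two_le_left, h.two_le_right, h.cosh_nonneg]
  two_le_right := h.two_le_right
  scale_nonneg := by linarith [h.left_pos, h.right_pos, h.scale_nonneg]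
  cosh_nonneg := by linarith [h.two_le_left, h.two_le_right, h.cosh_nonneg]
  scale_eq := by linear_combination h.scale_eq
  cosh_eq := by linear_combination h.cosh_eq
  det_left_right := by linear_combination 4 * h.det_left_right + h.det_right_third
  det_right_third := by linear_combination -h.det_left_right
  det_third_left := by linear_combination 4 * h.det_left_right + h.det_third_left

theorem cosh_mediant (h : IsGeodesicTriple α β γ φ ψ χ) :
    2 * φ + 2 * ψ + √(3 * (φ ^ 2 + ψ ^ 2 + 4 * φ * ψ + 3)) = 4 * (φ + ψ) - χ := by
  have : 3 * (φ ^ 2 + ψ ^ 2 + 4 * φ * ψ + 3) = (2 * (φ + ψ) - χ) ^ 2 := by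
    linear_combination -h.cosh_eq
  rw [this, Real.sqrt_sq h.cosh_nonneg]
  ring

theorem sq_det (h : IsGeodesicTriple α β γ φ ψ χ) :
    (α * ψ - β * φ) ^ 2 = α ^ 2 + β ^ 2 + 4 * (α * β) := by
  have h3 : √3 ^ 2 = (3 : ℝ) := Real.sq_sqrt (by norm_num)
  have : (√3 * (α * ψ - β * φ)) ^ 2 = (2 * (α + β) - γ) ^ 2 := by rw [h.det_left_right]
  rw [mul_pow, h3] at this
  linear_combination this / 3 + h.scale_eq / 3

theorem add_lt_det (h : IsGeodesicTriple α β γ φ ψ χ) : α + β < α * ψ - β * φ := by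
  have h3 : 0 < √(3 : ℝ) := by positivity
  have hD : 0 ≤ α * ψ - β * φ := by
    by_contra! hneg
    linarith [h.det_left_right, h.scale_nonneg, mul_neg_of_pos_of_neg h3 hneg]
  refine lt_of_pow_lt_pow_left₀ 2 hD ?_
  rw [h.sq_det]
  nlinarith [mul_pos h.left_pos h.right_pos]

theorem gap_eq (h : IsGeodesicTriple α β γ φ ψ χ) :
    (ψ - 1) / β - (φ + 1) / α = (α * ψ - β * φ - (α + β)) / (α * β) := by
  have := h.left_pos.ne'
  have := h.right_pos.ne'
  field_simp
  ring

theorem gap_pos (h : IsGeodesicTriple α β γ φ ψ χ) : (φ + 1) / α < (ψ - 1) / β := by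
  rw [← sub_pos, h.gap_eq]
  exact div_pos (sub_pos.mpr h.add_lt_det) (mul_pos h.left_pos h.right_pos)

/-- The geodesic inserted between the first two covers at least half of the gap. -/
theorem half_gap_le (h : IsGeodesicTriple α β γ φ ψ χ) :
    ((ψ - 1) / β - (φ + 1) / α) / 2 ≤ 2 / (4 * (α + β) - γ) := by
  have hαβ := mul_pos h.left_pos h.right_pos
  have hμ := h.left_s16.right_pos
  have hlt := h.add_lt_det
  have h3 : √(3 : ℝ) ≤ 2 := by
    rw [Real.sqrt_le_left (by norm_num)]
    norm_num
  rw [h.gap_eq, div_div, div_le_div_iff₀ (by positivity) hμ]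
  set D := α * ψ - β * φ with hDdef
  have hD0 : 0 < D := by linarith [h.left_pos, h.right_pos]
  have hμle : 4 * (α + β) - γ ≤ 2 * (D + (α + β)) := by
    have := h.det_left_right
    nlinarith
  calc (D - (α + β)) * (4 * (α + β) - γ)
      ≤ (D - (α + β)) * (2 * (D + (α + β))) :=
        mul_le_mul_of_nonneg_left hμle (sub_nonneg.mpr hlt.le)
    _ = 2 * (α * β * 2) := by linear_combination 2 * h.sq_det

end IsGeodesicTriple

theorem two_le_of_mem_mediants {Φ : ℚ → ℝ}
    (hrec : ∀ r s : ℚ, IsFareyPair r s →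
      Φ (mediant r s) = 2 * Φ r + 2 * Φ s + √(3 * (Φ r ^ 2 + Φ s ^ 2 + 4 * Φ r * Φ s + 3)))
    {n : ℕ} {r s q : ℚ} (hrs : IsFareyPair r s) (hr : 2 ≤ Φ r) (hs : 2 ≤ Φ s)
    (hq : q ∈ mediants n r s) : 2 ≤ Φ q := by
  induction n generalizing r s with
  | zero => simp [mediants] at hq
  | succ n ih =>
    have hm : 2 ≤ Φ (mediant r s) := by
      rw [hrec r s hrs]
      linarith [Real.sqrt_nonneg (3 * (Φ r ^ 2 + Φ s ^ 2 + 4 * Φ r * Φ s + 3))]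
    simp only [mediants, Finset.mem_insert, Finset.mem_union] at hq
    rcases hq with rfl | hq | hq
    · exact hm
    · exact ih hrs.left_s16 hr hm hq
    · exact ih hrs.right_s16 hm hs hq

/-- The shadows of the geodesics inserted in `n` steps fill the gap up to an error that decays
geometrically. -/
theorem sum_mediants_mem_Icc {Φ : ℚ → ℝ}
    (hrec : ∀ r s : ℚ, IsFareyPair r s →
      Φ (mediant r s) = 2 * Φ r + 2 * Φ s + √(3 * (Φ r ^ 2 + Φ s ^ 2 + 4 * Φ r * Φ s + 3)))
    {c : ℝ} (hc : 0 < c) (n : ℕ) {r s : ℚ} {α β γ χ : ℝ} (hrs : IsFareyPair r s)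
    (h : IsGeodesicTriple α β γ (Φ r) (Φ s) χ) (hcr : c ≤ (Φ r + 1) / α) :
    Real.log ((Φ s - 1) / β) - Real.log ((Φ r + 1) / α)
        - ∑ q ∈ mediants n r s, Real.log ((Φ q + 1) / (Φ q - 1)) ∈
      Set.Icc 0 ((1 / 2) ^ n * (((Φ s - 1) / β - (Φ r + 1) / α) / c)) := by
  induction n generalizing r s α β γ χ with
  | zero =>
    have hgap := h.gap_pos
    have hy : 0 < (Φ r + 1) / α := hc.trans_le hcr
    have hx : 0 < (Φ s - 1) / β := hy.trans hgap
    simp only [mediants, Finset.sum_empty, sub_zero, pow_zero, one_mul, Set.mem_Icc]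
    refine ⟨sub_nonneg.mpr (Real.log_le_log hy hgap.le), ?_⟩
    rw [← Real.log_div hx.ne' hy.ne']
    calc Real.log ((Φ s - 1) / β / ((Φ r + 1) / α))
        ≤ (Φ s - 1) / β / ((Φ r + 1) / α) - 1 := Real.log_le_sub_one_of_pos (by positivity)
      _ = ((Φ s - 1) / β - (Φ r + 1) / α) / ((Φ r + 1) / α) := by
        rw [sub_div _ ((Φ r + 1) / α), div_self hy.ne']
      _ ≤ _ := div_le_div_of_nonneg_left (sub_nonneg.mpr hgap.le) hc hcr
  | succ n ih =>
    have hm : Φ (mediant r s) = 4 * (Φ r + Φ s) - χ := by rw [hrec r s hrs, h.cosh_mediant]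
    have hl := h.left_s16
    have hr := h.right_s16
    rw [← hm] at hl hr
    have hμ := hl.right_pos
    have hm2 := hl.two_le_right
    have hhalf := h.half_gap_le
    set μ := 4 * (α + β) - γ
    set m := mediant r s
    have hlen : (Φ m + 1) / μ - (Φ m - 1) / μ = 2 / μ := by ring
    have hμ2 : 0 < 2 / μ := by positivity
    have hcm : c ≤ (Φ m + 1) / μ := by linarith [hl.gap_pos]
    obtain ⟨hl0, hl1⟩ := ih hrs.left_s16 hl hcr
    obtain ⟨hr0, hr1⟩ := ih hrs.right_s16 hr hcm
    have hlog : Real.log ((Φ m + 1) / (Φ m - 1)) =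
        Real.log ((Φ m + 1) / μ) - Real.log ((Φ m - 1) / μ) := by
      rw [Real.log_div (by linarith) (by linarith), Real.log_div (by linarith) hμ.ne',
        Real.log_div (by linarith) hμ.ne']
      ring
    rw [hrs.sum_mediants_succ, hlog]
    refine ⟨by linarith, ?_⟩
    have hsum : (1 / 2 : ℝ) ^ n * (((Φ m - 1) / μ - (Φ r + 1) / α) / c)
        + (1 / 2) ^ n * (((Φ s - 1) / β - (Φ m + 1) / μ) / c)
        ≤ (1 / 2) ^ (n + 1) * (((Φ s - 1) / β - (Φ r + 1) / α) / c) := by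
      rw [pow_succ, mul_assoc, ← mul_add, ← add_div]
      refine mul_le_mul_of_nonneg_left ?_ (by positivity)
      rw [← mul_div_assoc, div_le_div_iff_of_pos_right hc]
      linarith
    linarith

theorem isGeodesicTriple_base : IsGeodesicTriple (2 + √3) 1 0 2 2 (-1) := by
  have h3 : √3 ^ 2 = (3 : ℝ) := Real.sq_sqrt (by norm_num)
  have h0 : 0 ≤ √(3 : ℝ) := Real.sqrt_nonneg 3
  constructor <;> nlinarith

theorem log_div_nonneg_of_two_le {x : ℝ} (hx : 2 ≤ x) : 0 ≤ Real.log ((x + 1) / (x - 1)) := by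
  refine Real.log_nonneg ?_
  rw [le_div_iff₀ (by linarith)]
  linarith

theorem hasSum_log_div {Φ : ℚ → ℝ} (h0 : Φ 0 = 2) (h1 : Φ 1 = 2)
    (hrec : ∀ r s : ℚ, IsFareyPair r s →
      Φ (mediant r s) = 2 * Φ r + 2 * Φ s + √(3 * (Φ r ^ 2 + Φ s ^ 2 + 4 * Φ r * Φ s + 3))) :
    HasSum (fun q : {q : ℚ // q ∈ Set.Icc (0 : ℚ) 1} => Real.log ((Φ q + 1) / (Φ q - 1)))
      (Real.log (3 * (2 + √3))) := by
  set f : ℚ → ℝ := fun q => Real.log ((Φ q + 1) / (Φ q - 1)) with hf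
  have mem_level {n : ℕ} {q : ℚ} (hq : q ∈ Set.Icc (0 : ℚ) 1) (hn : q.den ≤ n) :
      q ∈ insert 0 (insert 1 (mediants n 0 1)) := by
    simp only [Finset.mem_insert]
    rcases hq.1.eq_or_lt with h | hpos
    · exact .inl h.symm
    rcases hq.2.eq_or_lt with h | hlt
    · exact .inr (.inl h)
    · exact .inr (.inr (isFareyPair_zero_one.mem_mediants hpos hlt (by simp; omega)))
  have two_le {n : ℕ} {q : ℚ} (hq : q ∈ insert 0 (insert 1 (mediants n 0 1))) : 2 ≤ Φ q := by
    simp only [Finset.mem_insert] at hq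
    rcases hq with rfl | rfl | hq
    · exact h0.ge
    · exact h1.ge
    · exact two_le_of_mem_mediants hrec isFareyPair_zero_one h0.ge h1.ge hq
  have level_subset {n : ℕ} {q : ℚ} (hq : q ∈ insert 0 (insert 1 (mediants n 0 1))) :
      q ∈ Set.Icc (0 : ℚ) 1 := by
    simp only [Finset.mem_insert] at hq
    rcases hq with rfl | rfl | hq
    · simp
    · simp
    · have := isFareyPair_zero_one.mem_Ioo_of_mem_mediants hq
      exact ⟨this.1.le, this.2.le⟩
  have hs : 0 < 2 + √(3 : ℝ) := by positivity
  obtain ⟨K, hK⟩ : ∃ K : ℝ, ∀ n : ℕ, Real.log (3 * (2 + √3))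
      - ∑ q ∈ insert 0 (insert 1 (mediants n 0 1)), f q ∈ Set.Icc 0 ((1 / 2) ^ n * K) := by
    have hbase : IsGeodesicTriple (2 + √3) 1 0 (Φ 0) (Φ 1) (-1) := by
      rw [h0, h1]
      exact isGeodesicTriple_base
    have hc : 0 < (Φ 0 + 1) / (2 + √3) := by rw [h0]; positivity
    refine ⟨((Φ 1 - 1) / 1 - (Φ 0 + 1) / (2 + √3)) / ((Φ 0 + 1) / (2 + √3)), fun n => ?_⟩
    have key := sum_mediants_mem_Icc hrec hc n isFareyPair_zero_one hbase le_rfl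
    have hsum : ∑ q ∈ insert 0 (insert 1 (mediants n 0 1)), f q
        = Real.log 3 + Real.log 3 + ∑ q ∈ mediants n 0 1, f q := by
      rw [Finset.sum_insert, Finset.sum_insert]
      · have e0 : f 0 = Real.log 3 := by simp only [hf, h0]; norm_num
        have e1 : f 1 = Real.log 3 := by simp only [hf, h1]; norm_num
        rw [e0, e1]
        ring
      · intro hmem
        exact lt_irrefl _ (isFareyPair_zero_one.mem_Ioo_of_mem_mediants hmem).2
      · intro hmem
        rcases Finset.mem_insert.mp hmem with hmem | hmem
        · norm_num at hmem
        · exact lt_irrefl _ (isFareyPair_zero_one.mem_Ioo_of_mem_mediants hmem).1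
    have hval : Real.log ((Φ 1 - 1) / 1) - Real.log ((Φ 0 + 1) / (2 + √3))
        = Real.log (3 * (2 + √3)) - (Real.log 3 + Real.log 3) := by
      rw [h0, h1, Real.log_mul (by norm_num) hs.ne', Real.log_div (by norm_num) hs.ne']
      norm_num
    rw [hsum, ← sub_sub, ← hval]
    exact key
  change HasSum (f ∘ ((↑) : Set.Icc (0 : ℚ) 1 → ℚ)) _
  rw [hasSum_subtype_iff_indicator]
  refine hasSum_of_isLUB_of_nonneg _ (fun q => Set.indicator_nonneg (fun q hq =>
    log_div_nonneg_of_two_le (two_le (mem_level hq le_rfl))) q) ⟨?_, ?_⟩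
  · rintro _ ⟨u, rfl⟩
    set n := u.sup Rat.den
    calc ∑ q ∈ u, (Set.Icc (0 : ℚ) 1).indicator f q
        = ∑ q ∈ u with q ∈ Set.Icc (0 : ℚ) 1, f q := by
          simp only [Finset.sum_filter, Set.indicator_apply]
      _ ≤ ∑ q ∈ insert 0 (insert 1 (mediants n 0 1)), f q := by
          refine Finset.sum_le_sum_of_subset_of_nonneg (fun q hq => ?_)
            fun q hq _ => log_div_nonneg_of_two_le (two_le hq)
          rw [Finset.mem_filter] at hq
          exact mem_level hq.2 (Finset.le_sup (f := Rat.den) hq.1)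
      _ ≤ _ := sub_nonneg.mp (hK n).1
  · intro b hb
    have hlim : Filter.Tendsto (fun n : ℕ => b + (1 / 2 : ℝ) ^ n * K) Filter.atTop
        (nhds (b + 0 * K)) :=
      ((tendsto_pow_atTop_nhds_zero_of_lt_one (by norm_num) (by norm_num)).mul_const K).const_add b
    rw [zero_mul, add_zero] at hlim
    refine ge_of_tendsto' hlim fun n => ?_
    have hle : ∑ q ∈ insert 0 (insert 1 (mediants n 0 1)), f q ≤ b := by
      refine le_of_eq_of_le (Finset.sum_congr rfl fun q hq => ?_)
        (hb ⟨insert 0 (insert 1 (mediants n 0 1)), rfl⟩)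
      exact (Set.indicator_of_mem (level_subset hq) f).symm
    linarith [(hK n).2]

theorem stmt_16 (Φ : ℚ → ℝ) (h0 : Φ 0 = 2) (h1 : Φ 1 = 2)
    (hrec : ∀ r s : ℚ, IsFareyPair r s →
      Φ (mediant r s) =
        2 * Φ r + 2 * Φ s +
          Real.sqrt (3 * (Φ r ^ 2 + Φ s ^ 2 + 4 * Φ r * Φ s + 3))) :
    Summable (fun q : {q : ℚ // q ∈ Set.Icc (0 : ℚ) 1} =>
        Real.log ((Φ q + 1) / (Φ q - 1))) ∧
      Real.exp (∑' q : {q : ℚ // q ∈ Set.Icc (0 : ℚ) 1},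
          Real.log ((Φ q + 1) / (Φ q - 1))) = 3 * (2 + Real.sqrt 3) := by
  have h := hasSum_log_div h0 h1 hrec
  refine ⟨h.summable, ?_⟩
  rw [h.tsum_eq, Real.exp_log (by positivity)]
end
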